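/- Let a, b, c, d be real, let n ≥ k ≥ 0 be integers, and let (x,y) be real with x ≠ 1; write u(x,y) = P_{n,k}^{(a,b,c,d)}(x,y) and z = 1−x−y. Then: (k+b+c+1)·u + y·∂u/∂y = (k+b+c+1)·P_{n,k}^{(a,b,c+1,d−1)}(x,y); (c + k − yk/(1−x))·u − (y/(1−x))·z·∂u/∂y = (k+c)·P_{n,k}^{(a,b,c−1,d+1)}(x,y); (k+b+c+1)·u − z·∂u/∂y = (k+b+c+1)·P_{n,k}^{(a,b+1,c,d−1)}(x,y); and (b + ky/(1−x))·u + (y/(1−x))·z·∂u/∂y = (k+b)·P_{n,k}^{(a,b−1,c,d+1)}(x,y). -/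

import Mathlib

noncomputable section

/-- Generalized binomial coefficient `C(α, j) = α(α−1)⋯(α−j+1)/j!`. -/
def genBinom (α : ℝ) (j : ℕ) : ℝ :=
  (∏ i ∈ Finset.range j, (α - i)) / (Nat.factorial j)

/-- Jacobi polynomial `P_n^{(a,b)}(x)`; zero for negative `n`. -/
def jacobiP (n : ℤ) (a b : ℝ) (x : ℝ) : ℝ :=
  if n < 0 then 0 else
    ∑ m ∈ Finset.range (n.toNat + 1),
      genBinom ((n : ℝ) + a) (n.toNat - m) * genBinom ((n : ℝ) + b) m *
        ((x - 1) / 2) ^ m * ((x + 1) / 2) ^ (n.toNat - m)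

/-- Four-parameter Koornwinder polynomial `P_{n,k}^{(a,b,c,d)}(x,y)`;
zero whenever `k < 0`, `n < 0`, or `k > n` (covering the conventions
`k = −1`, `n = −1`, `k = n+1`). -/
def koornP (n k : ℤ) (a b c d : ℝ) (x y : ℝ) : ℝ :=
  if n < 0 ∨ k < 0 ∨ n < k then 0 else
    jacobiP (n - k) (2 * (k : ℝ) + b + c + d + 1) a (2 * x - 1) *
      (1 - x) ^ k.toNat * jacobiP k c b (-1 + 2 * y / (1 - x))

open Finset

@[simp]
theorem genBinom_zero (α : ℝ) : genBinom α 0 = 1 := by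
  simp [genBinom]

theorem succ_mul_genBinom_succ (α : ℝ) (j : ℕ) :
    ((j : ℝ) + 1) * genBinom α (j + 1) = (α - j) * genBinom α j := by
  have h1 : (Nat.factorial j : ℝ) ≠ 0 := by positivity
  have h2 : (j : ℝ) + 1 ≠ 0 := by positivity
  simp only [genBinom, prod_range_succ, Nat.factorial_succ, Nat.cast_mul, Nat.cast_add,
    Nat.cast_one]
  field_simp

theorem succ_mul_genBinom_add_one (α : ℝ) (j : ℕ) :
    ((j : ℝ) + 1) * genBinom (α + 1) (j + 1) = (α + 1) * genBinom α j := by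
  have h1 : (Nat.factorial j : ℝ) ≠ 0 := by positivity
  have h2 : (j : ℝ) + 1 ≠ 0 := by positivity
  have h3 : ∏ i ∈ range (j + 1), (α + 1 - (i : ℝ)) = (∏ i ∈ range j, (α - i)) * (α + 1) := by
    rw [prod_range_succ']
    simp
  simp only [genBinom, h3, Nat.factorial_succ, Nat.cast_mul, Nat.cast_add, Nat.cast_one]
  field_simp

theorem sub_mul_genBinom (α : ℝ) (j : ℕ) :
    (α - j) * genBinom α j = α * genBinom (α - 1) j := by
  have h := succ_mul_genBinom_add_one (α - 1) j
  rw [sub_add_cancel] at h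
  rw [← succ_mul_genBinom_succ, h]

theorem genBinom_add_one_succ (α : ℝ) (j : ℕ) :
    genBinom (α + 1) (j + 1) = genBinom α (j + 1) + genBinom α j := by
  have h2 : (j : ℝ) + 1 ≠ 0 := by positivity
  apply mul_left_cancel₀ h2
  linear_combination succ_mul_genBinom_add_one α j - succ_mul_genBinom_succ α j

/-- The homogeneous two-variable form of the Jacobi polynomial of degree `k`. -/
def jacobiForm (k : ℕ) (c b p q : ℝ) : ℝ :=
  ∑ ij ∈ antidiagonal k,
    genBinom (k + c) ij.2 * genBinom (k + b) ij.1 * p ^ ij.1 * q ^ ij.2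

/-- The partial derivative of `jacobiForm` in its first variable. -/
def jacobiFormFst (k : ℕ) (c b p q : ℝ) : ℝ :=
  ∑ ij ∈ antidiagonal k,
    genBinom (k + c) ij.2 * genBinom (k + b) ij.1 * (ij.1 * p ^ (ij.1 - 1)) * q ^ ij.2

theorem jacobiForm_swap (k : ℕ) (c b p q : ℝ) :
    jacobiForm k c b p q = jacobiForm k b c q p := by
  unfold jacobiForm
  rw [← Nat.sum_antidiagonal_swap]
  exact sum_congr rfl fun ij _ => by simp only [Prod.fst_swap, Prod.snd_swap]; ring

theorem jacobiP_natCast (k : ℕ) (c b v : ℝ) :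
    jacobiP k c b v = jacobiForm k c b ((v - 1) / 2) ((v + 1) / 2) := by
  rw [jacobiP, if_neg (by simp), jacobiForm, Nat.sum_antidiagonal_eq_sum_range_succ_mk]
  simp

theorem natCast_mul_pow_pred_mul (i : ℕ) (p : ℝ) : (i : ℝ) * p ^ (i - 1) * p = i * p ^ i := by
  cases i with
  | zero => simp
  | succ i => simp [pow_succ, mul_assoc]

theorem mul_jacobiFormFst (k : ℕ) (c b p q : ℝ) :
    p * jacobiFormFst k c b p q = ∑ ij ∈ antidiagonal k,
      ij.1 * (genBinom (k + c) ij.2 * genBinom (k + b) ij.1 * p ^ ij.1 * q ^ ij.2) := by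
  rw [jacobiFormFst, mul_sum]
  refine sum_congr rfl fun ij _ => ?_
  linear_combination genBinom (k + c) ij.2 * genBinom (k + b) ij.1 * q ^ ij.2 *
    natCast_mul_pow_pred_mul ij.1 p

/-- Euler's identity for the homogeneous polynomial `jacobiForm`. -/
theorem jacobiForm_euler (k : ℕ) (c b p q : ℝ) :
    p * jacobiFormFst k c b p q + q * jacobiFormFst k b c q p = k * jacobiForm k c b p q := by
  rw [mul_jacobiFormFst, mul_jacobiFormFst, ← Nat.sum_antidiagonal_swap (n := k) (f := fun ij =>
    (ij.1 : ℝ) * (genBinom (k + b) ij.2 * genBinom (k + c) ij.1 * q ^ ij.1 * p ^ ij.2)),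
    ← sum_add_distrib, jacobiForm, mul_sum]
  refine sum_congr rfl fun ij hij => ?_
  have h : (ij.1 : ℝ) + ij.2 = k := by exact_mod_cast mem_antidiagonal.mp hij
  simp only [Prod.fst_swap, Prod.snd_swap]
  rw [← h]
  ring

theorem jacobiForm_sub_one (k : ℕ) (c b p q : ℝ) :
    c * jacobiForm k c b p q + p * jacobiFormFst k c b p q
      = (k + c) * jacobiForm k (c - 1) b p q := by
  rw [mul_jacobiFormFst, jacobiForm, jacobiForm, mul_sum, mul_sum, ← sum_add_distrib]
  refine sum_congr rfl fun ij hij => ?_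
  have h : (ij.1 : ℝ) + ij.2 = k := by exact_mod_cast mem_antidiagonal.mp hij
  have h1 := sub_mul_genBinom (k + c) ij.2
  rw [add_sub_assoc (k : ℝ) c 1] at h1
  linear_combination genBinom (k + b) ij.1 * p ^ ij.1 * q ^ ij.2 * h1
    + genBinom (k + c) ij.2 * genBinom (k + b) ij.1 * p ^ ij.1 * q ^ ij.2 * h

theorem jacobiForm_add_one (k : ℕ) (c b p q : ℝ) :
    (k + b + c + 1) * jacobiForm k c b p q
        + q * (jacobiFormFst k c b p q + jacobiFormFst k b c q p)
      = (k + b + c + 1) * jacobiForm k (c + 1) b p q := by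
  cases k with
  | zero => simp [jacobiForm, jacobiFormFst]
  | succ n =>
    have e : (((n + 1 : ℕ) : ℝ) + b + c + 1) * jacobiForm (n + 1) c b p q
          + q * jacobiFormFst (n + 1) b c q p
        = ∑ ij ∈ antidiagonal (n + 1), (((n + 1 : ℕ) : ℝ) + b + c + 1 + ij.2) *
          (genBinom ((n + 1 : ℕ) + c) ij.2 * genBinom ((n + 1 : ℕ) + b) ij.1 *
            p ^ ij.1 * q ^ ij.2) := by
      rw [mul_jacobiFormFst, ← Nat.sum_antidiagonal_swap, jacobiForm, mul_sum, ← sum_add_distrib]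
      refine sum_congr rfl fun ij _ => ?_
      simp only [Prod.fst_swap, Prod.snd_swap]
      ring
    rw [mul_add, add_comm (q * _), ← add_assoc, e, jacobiFormFst, jacobiForm,
      Nat.sum_antidiagonal_succ', Nat.sum_antidiagonal_succ, Nat.sum_antidiagonal_succ']
    simp only [Nat.cast_zero, zero_mul, mul_zero, zero_add, add_zero, genBinom_zero, pow_zero,
      mul_one, Nat.add_sub_cancel, mul_add, mul_sum]
    rw [add_assoc, ← sum_add_distrib]
    congr 1
    refine sum_congr rfl fun ij hij => ?_
    have h : (ij.1 : ℝ) + ij.2 = n := by exact_mod_cast mem_antidiagonal.mp hij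
    have h1 := succ_mul_genBinom_succ ((n + 1 : ℕ) + c) ij.2
    have h2 := succ_mul_genBinom_succ ((n + 1 : ℕ) + b) ij.1
    have h3 := genBinom_add_one_succ ((n + 1 : ℕ) + c) ij.2
    rw [← add_assoc, h3]
    push_cast at *
    rw [← h] at *
    generalize genBinom (_ + c) (ij.2 + 1) = A at *
    generalize genBinom (_ + c) ij.2 = A' at *
    generalize genBinom (_ + b) (ij.1 + 1) = B at *
    generalize genBinom (_ + b) ij.1 = B' at *
    linear_combination (p ^ ij.1 * q ^ (ij.2 + 1)) * (B' * h1 + A' * h2)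

theorem hasDerivAt_jacobiForm (k : ℕ) (c b : ℝ) {f g : ℝ → ℝ} {r y : ℝ}
    (hf : HasDerivAt f r y) (hg : HasDerivAt g r y) :
    HasDerivAt (fun y => jacobiForm k c b (f y) (g y))
      (r * (jacobiFormFst k c b (f y) (g y) + jacobiFormFst k b c (g y) (f y))) y := by
  have h := HasDerivAt.fun_sum (u := antidiagonal k) fun ij _ =>
    ((hf.fun_pow ij.1).const_mul (genBinom (k + c) ij.2 * genBinom (k + b) ij.1)).fun_mul
      (hg.fun_pow ij.2)
  refine h.congr_deriv ?_
  rw [jacobiFormFst, jacobiFormFst, ← Nat.sum_antidiagonal_swap (n := k) (f := fun ij =>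
    genBinom (k + b) ij.2 * genBinom (k + c) ij.1 * (ij.1 * g y ^ (ij.1 - 1)) * f y ^ ij.2),
    ← sum_add_distrib, mul_sum]
  refine sum_congr rfl fun ij _ => ?_
  simp only [Prod.fst_swap, Prod.snd_swap]
  ring

theorem koornP_eq_jacobiForm {n : ℤ} {k : ℕ} (hnk : (k : ℤ) ≤ n) (a b c d x y : ℝ) :
    koornP n k a b c d x y = jacobiP (n - k) (2 * (k : ℝ) + b + c + d + 1) a (2 * x - 1) *
      (1 - x) ^ k * jacobiForm k c b (y / (1 - x) - 1) (y / (1 - x)) := by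
  rw [koornP, if_neg (by omega), jacobiP_natCast, Int.toNat_natCast, Int.cast_natCast]
  congr 2 <;> ring

theorem koorn_ladder_M02_M03 (a b c d : ℝ) (n k : ℤ) (hk : 0 ≤ k) (hnk : k ≤ n)
    (x y : ℝ) (hx : x ≠ 1) :
    (((k : ℝ) + b + c + 1) * koornP n k a b c d x y
        + y * deriv (koornP n k a b c d x) y
      = ((k : ℝ) + b + c + 1) * koornP n k a b (c + 1) (d - 1) x y) ∧
    ((c + (k : ℝ) - y * (k : ℝ) / (1 - x)) * koornP n k a b c d x y
        - (y / (1 - x)) * (1 - x - y) * deriv (koornP n k a b c d x) y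
      = ((k : ℝ) + c) * koornP n k a b (c - 1) (d + 1) x y) ∧
    (((k : ℝ) + b + c + 1) * koornP n k a b c d x y
        - (1 - x - y) * deriv (koornP n k a b c d x) y
      = ((k : ℝ) + b + c + 1) * koornP n k a (b + 1) c (d - 1) x y) ∧
    ((b + (k : ℝ) * y / (1 - x)) * koornP n k a b c d x y
        + (y / (1 - x)) * (1 - x - y) * deriv (koornP n k a b c d x) y
      = ((k : ℝ) + b) * koornP n k a (b - 1) c (d + 1) x y) := by
  lift k to ℕ using hk
  have hw : 1 - x ≠ 0 := sub_ne_zero.mpr hx.symm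
  have hq : HasDerivAt (fun y : ℝ => y / (1 - x)) (1 / (1 - x)) y :=
    (hasDerivAt_id y).div_const (1 - x)
  have hu := ((hasDerivAt_jacobiForm k c b (hq.sub_const 1) hq).const_mul
    (jacobiP (n - k) (2 * (k : ℝ) + b + c + d + 1) a (2 * x - 1) * (1 - x) ^ k)).deriv
  rw [show koornP n k a b c d x = _ from funext (koornP_eq_jacobiForm hnk a b c d x), hu]
  simp only [koornP_eq_jacobiForm hnk, Int.cast_natCast]
  rw [show 2 * (k : ℝ) + b + (c + 1) + (d - 1) + 1 = 2 * k + b + c + d + 1 by ring,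
    show 2 * (k : ℝ) + b + (c - 1) + (d + 1) + 1 = 2 * k + b + c + d + 1 by ring,
    show 2 * (k : ℝ) + (b + 1) + c + (d - 1) + 1 = 2 * k + b + c + d + 1 by ring,
    show 2 * (k : ℝ) + (b - 1) + c + (d + 1) + 1 = 2 * k + b + c + d + 1 by ring]
  generalize jacobiP (n - k) (2 * (k : ℝ) + b + c + d + 1) a (2 * x - 1) * (1 - x) ^ k = A
  obtain ⟨t, rfl⟩ : ∃ t, y = t * (1 - x) := ⟨y / (1 - x), by field_simp⟩
  have ht : t * (1 - x) / (1 - x) = t := mul_div_cancel_right₀ t hw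
  have hw' : (1 - x) * (1 / (1 - x)) = 1 := mul_one_div_cancel hw
  have hkt : t * (1 - x) * k / (1 - x) = t * k := by field_simp
  have hkt' : k * (t * (1 - x)) / (1 - x) = k * t := by field_simp
  rw [ht, hkt, hkt']
  have euler := jacobiForm_euler k c b (t - 1) t
  have c_up := jacobiForm_add_one k c b (t - 1) t
  have c_down := jacobiForm_sub_one k c b (t - 1) t
  have b_up := jacobiForm_add_one k b c t (t - 1)
  have b_down := jacobiForm_sub_one k b c t (t - 1)
  simp only [jacobiForm_swap k _ _ t (t - 1)] at b_up b_down
  set F := jacobiForm k c b (t - 1) t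
  set D := jacobiFormFst k c b (t - 1) t
  set E := jacobiFormFst k b c t (t - 1)
  refine ⟨?_, ?_, ?_, ?_⟩
  · linear_combination A * c_up + A * t * (D + E) * hw'
  · linear_combination A * c_down + A * (t - 1) * euler - A * t * (1 - t) * (D + E) * hw'
  · linear_combination A * b_up - A * (1 - t) * (D + E) * hw'
  · linear_combination A * b_down - A * t * euler + A * t * (1 - t) * (D + E) * hw'
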